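/- The coefficients of the alternative canonic form are unique: if A is a quaternion and b, v_1, v_2, v_3 are pure quaternions such that A·q + q·b + v_1·q·i + v_2·q·j + v_3·q·k = 0 for all quaternions q, then A = 0, b = 0, v_1 = 0, v_2 = 0, and v_3 = 0. -/

import Mathlib

open scoped Quaternion

/-- The imaginary units of the real quaternions. -/
def qi : ℍ[ℝ] := ⟨0, 1, 0, 0⟩
def qj : ℍ[ℝ] := ⟨0, 0, 1, 0⟩
def qk : ℍ[ℝ] := ⟨0, 0, 0, 1⟩

theorem qi_re : qi.re = 0 := rfl
theorem qi_imI : qi.imI = 1 := rfl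
theorem qi_imJ : qi.imJ = 0 := rfl
theorem qi_imK : qi.imK = 0 := rfl

theorem qj_re : qj.re = 0 := rfl
theorem qj_imI : qj.imI = 0 := rfl
theorem qj_imJ : qj.imJ = 1 := rfl
theorem qj_imK : qj.imK = 0 := rfl

theorem qk_re : qk.re = 0 := rfl
theorem qk_imI : qk.imI = 0 := rfl
theorem qk_imJ : qk.imJ = 0 := rfl
theorem qk_imK : qk.imK = 1 := rfl

/-- uniqueness of the coefficients of the alternative canonic form. -/
theorem stmt_14 (A b v₁ v₂ v₃ : ℍ[ℝ])
    (hb : b.re = 0) (hv₁ : v₁.re = 0) (hv₂ : v₂.re = 0) (hv₃ : v₃.re = 0)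
    (h : ∀ q : ℍ[ℝ], A * q + q * b + v₁ * q * qi + v₂ * q * qj + v₃ * q * qk = 0) :
    A = 0 ∧ b = 0 ∧ v₁ = 0 ∧ v₂ = 0 ∧ v₃ = 0 := by
  have h₁ := h 1
  have h₂ := h qi
  have h₃ := h qj
  have h₄ := h qk
  simp only [Quaternion.ext_iff, qi_re, qi_imI, qi_imJ, qi_imK,
    qj_re, qj_imI, qj_imJ, qj_imK,
    qk_re, qk_imI, qk_imJ, qk_imK,
    Quaternion.re_add, Quaternion.imI_add,
    Quaternion.imJ_add, Quaternion.imK_add, Quaternion.re_mul, Quaternion.imI_mul,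
    Quaternion.imJ_mul, Quaternion.imK_mul, Quaternion.re_one, Quaternion.imI_one,
    Quaternion.imJ_one, Quaternion.imK_one, Quaternion.re_zero, Quaternion.imI_zero,
    Quaternion.imJ_zero, Quaternion.imK_zero, hb, hv₁, hv₂, hv₃] at h₁ h₂ h₃ h₄ ⊢
  obtain ⟨_, _, _, _⟩ := h₁
  obtain ⟨_, _, _, _⟩ := h₂
  obtain ⟨_, _, _, _⟩ := h₃
  obtain ⟨_, _, _, _⟩ := h₄
  refine ⟨⟨?_, ?_, ?_, ?_⟩, ⟨trivial, ?_, ?_, ?_⟩, ⟨trivial, ?_, ?_, ?_⟩, ⟨trivial, ?_, ?_, ?_⟩,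
    ⟨trivial, ?_, ?_, ?_⟩⟩ <;> linarith
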